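/- arXiv:1604.06288 — 2 statements merged into one kernel-verified Lean document; each statement's English description precedes it below -/
import Mathlib

section
/- For every L > 0, every p > 2 and every λ ∈ ℝ, there exists a function φ : ℝ → ℝ that is odd, L-periodic, of class C², not identically zero, and solves φ''(x) + |φ(x)|^{p−2}·φ(x) = λ·φ(x) for every x ∈ ℝ. -/
open intervalIntegral in
/-- An autonomous scalar equation `θ' = W θ` with `W` continuous, positive, even and periodic has
an odd bijective solution, which advances by the period `T` of `W` in time `∫₀ᵀ 1 / W`. -/
theorem exists_odd_bijective_solution_of_periodic {W : ℝ → ℝ} {T : ℝ} (hW : Continuous W)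
    (hpos : ∀ t, 0 < W t) (heven : ∀ t, W (-t) = W t) (hT : 0 < T)
    (hper : Function.Periodic W T) :
    ∃ θ : ℝ → ℝ, Function.Bijective θ ∧ (∀ x, HasDerivAt θ (W (θ x)) x) ∧
      (∀ x, θ (-x) = -θ x) ∧ ∀ x, θ (x + ∫ t in (0 : ℝ)..T, (W t)⁻¹) = θ x + T := by
  have hg : Continuous fun t => (W t)⁻¹ := hW.inv₀ fun t => (hpos t).ne'
  have hgper : Function.Periodic (fun t => (W t)⁻¹) T := fun t => by simp only [hper t]
  have hint : ∀ a b, IntervalIntegrable (fun t => (W t)⁻¹) MeasureTheory.volume a b :=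
    fun a b => hg.intervalIntegrable a b
  set X : ℝ → ℝ := fun s => ∫ t in (0 : ℝ)..s, (W t)⁻¹ with hX
  have hderiv : ∀ s, HasDerivAt X (W s)⁻¹ s :=
    fun s => hg.integral_hasStrictDerivAt 0 s |>.hasDerivAt
  have hmono : StrictMono X :=
    strictMono_of_hasDerivAt_pos hderiv fun s => inv_pos.2 (hpos s)
  have hcont : Continuous X := continuous_iff_continuousAt.2 fun s => (hderiv s).continuousAt
  have hP : 0 < ∫ t in (0 : ℝ)..T, (W t)⁻¹ :=
    intervalIntegral_pos_of_pos (hint _ _) (fun t => inv_pos.2 (hpos t)) hT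
  have hsurj : Function.Surjective X :=
    hcont.surjective (hgper.tendsto_atTop_intervalIntegral_of_pos hP hT)
      (hgper.tendsto_atBot_intervalIntegral_of_pos hP hT)
  have hodd : ∀ s, X (-s) = -X s := fun s => by
    have h := integral_comp_neg (a := 0) (b := s) fun t => (W t)⁻¹
    simp only [heven, neg_zero] at h
    rw [hX]
    simp only
    rw [h, integral_symm]
  have hadd : ∀ s, X (s + T) = X s + ∫ t in (0 : ℝ)..T, (W t)⁻¹ := fun s => by
    rw [hX]
    simp only
    rw [← integral_add_adjacent_intervals (hint 0 s) (hint s (s + T)),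
      hgper.intervalIntegral_add_eq s 0, zero_add]
  let e := hmono.orderIsoOfSurjective X hsurj
  have he : ∀ x, X (e.symm x) = x := fun x => e.apply_symm_apply x
  refine ⟨e.symm, e.symm.bijective, fun x => ?_, fun x => hmono.injective ?_,
    fun x => hmono.injective ?_⟩
  · have h := HasDerivAt.of_local_left_inverse e.symm.continuous.continuousAt
      (hderiv (e.symm x)) (inv_pos.2 (hpos _)).ne' (Filter.Eventually.of_forall he)
    simpa using h
  · rw [hodd, he, he]
  · rw [hadd, he, he]

/-- A continuous function with the prescribed continuous derivative off a countable set has this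
derivative everywhere. -/
theorem hasDerivAt_of_hasDerivAt_off_countable {f g : ℝ → ℝ} {s : Set ℝ} (hs : s.Countable)
    (hf : Continuous f) (hg : Continuous g) (h : ∀ x ∉ s, HasDerivAt f (g x) x) (x : ℝ) :
    HasDerivAt f (g x) x := by
  have key : f = fun y => f 0 + ∫ t in (0 : ℝ)..y, g t := by
    funext y
    rw [MeasureTheory.integral_eq_of_hasDerivAt_off_countable f g hs hf.continuousOn
      (fun z hz => h z hz.2) (hg.intervalIntegrable _ _)]
    ring
  rw [key]
  exact (hg.integral_hasStrictDerivAt 0 x).hasDerivAt.const_add _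

/-- The difference quotient `(1 - u ^ q) / (1 - u)`, continuously extended to `u = 1`. -/
noncomputable def powSlope (q : ℝ) : ℝ → ℝ := dslope (fun u : ℝ => u ^ q) 1

theorem differentiable_rpow_const_of_one_le {q : ℝ} (hq : 1 ≤ q) :
    Differentiable ℝ fun u : ℝ => u ^ q :=
  fun u => (Real.hasDerivAt_rpow_const (x := u) (Or.inr hq)).differentiableAt

theorem continuous_powSlope {q : ℝ} (hq : 1 ≤ q) : Continuous (powSlope q) := by
  rw [← continuousOn_univ]
  exact (continuousOn_dslope Filter.univ_mem).2
    ⟨(differentiable_rpow_const_of_one_le hq).continuous.continuousOn,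
      differentiable_rpow_const_of_one_le hq 1⟩

theorem differentiableAt_powSlope {q u : ℝ} (hq : 1 ≤ q) (hu : u ≠ 1) :
    DifferentiableAt ℝ (powSlope q) u :=
  (differentiableAt_dslope_of_ne hu).2 (differentiable_rpow_const_of_one_le hq u)

theorem one_sub_mul_powSlope (q u : ℝ) : (1 - u) * powSlope q u = 1 - u ^ q := by
  have h := sub_smul_dslope (fun u : ℝ => u ^ q) 1 u
  simp only [smul_eq_mul, Real.one_rpow] at h
  rw [powSlope]
  linarith

theorem one_le_powSlope {q u : ℝ} (hq : 1 ≤ q) (h0 : 0 ≤ u) (h1 : u ≤ 1) :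
    1 ≤ powSlope q u := by
  rcases h1.eq_or_lt with rfl | h1
  · rw [powSlope, dslope_same, (Real.hasDerivAt_rpow_const (Or.inr hq)).deriv]
    simpa using hq
  · have h := one_sub_mul_powSlope q u
    have h2 : u ^ q ≤ u := by
      simpa using Real.rpow_le_rpow_of_exponent_ge' h0 h1.le zero_le_one hq
    nlinarith

/-- The squared angular speed, truncated below by `1`, of the solution whose amplitude `a`
satisfies `a ^ (p - 2) = A`. -/
noncomputable def angularSpeedSq (p lam A t : ℝ) : ℝ :=
  max 1 (A * (2 / p * powSlope (p / 2) (Real.sin t ^ 2)) - lam)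

section

variable {p lam A : ℝ}

theorem angularSpeedSq_pos (t : ℝ) : 0 < angularSpeedSq p lam A t :=
  zero_lt_one.trans_le (le_max_left _ _)

theorem continuous_angularSpeedSq (hp : 2 < p) (lam : ℝ) :
    Continuous fun z : ℝ × ℝ => angularSpeedSq p lam z.1 z.2 := by
  have := continuous_powSlope (q := p / 2) (by linarith)
  unfold angularSpeedSq
  fun_prop

theorem two_div_mul_le (hp : 2 < p) (hA : 0 ≤ A) (t : ℝ) :
    2 * A / p - lam ≤ A * (2 / p * powSlope (p / 2) (Real.sin t ^ 2)) - lam := by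
  have h := one_le_powSlope (q := p / 2) (u := Real.sin t ^ 2) (by linarith) (sq_nonneg _)
    (Real.sin_sq_le_one t)
  have h2 : 0 ≤ A * (2 / p) := by positivity
  have h3 := mul_le_mul_of_nonneg_left h h2
  have h4 : 2 * A / p = A * (2 / p) * 1 := by ring
  rw [h4, ← mul_assoc]
  linarith

theorem angularSpeedSq_eq (hp : 2 < p) (hA : 0 ≤ A) (h : 1 ≤ 2 * A / p - lam) (t : ℝ) :
    angularSpeedSq p lam A t = A * (2 / p * powSlope (p / 2) (Real.sin t ^ 2)) - lam :=
  max_eq_right (h.trans (two_div_mul_le hp hA t))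

theorem le_angularSpeedSq (hp : 2 < p) (hA : 0 ≤ A) (t : ℝ) :
    2 * A / p - lam ≤ angularSpeedSq p lam A t :=
  (two_div_mul_le hp hA t).trans (le_max_right _ _)

end

/-- The period of the solution whose amplitude `a` satisfies `a ^ (p - 2) = A`. -/
noncomputable def nlsPeriod (p lam A : ℝ) : ℝ :=
  ∫ t in (0 : ℝ)..2 * Real.pi, (√(angularSpeedSq p lam A t))⁻¹

theorem continuous_inv_sqrt_angularSpeedSq {p : ℝ} (hp : 2 < p) (lam : ℝ) :
    Continuous fun z : ℝ × ℝ => (√(angularSpeedSq p lam z.1 z.2))⁻¹ :=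
  (continuous_angularSpeedSq hp lam).sqrt.inv₀
    fun _ => (Real.sqrt_pos.2 (angularSpeedSq_pos _)).ne'

theorem continuous_nlsPeriod {p : ℝ} (hp : 2 < p) (lam : ℝ) : Continuous (nlsPeriod p lam) :=
  intervalIntegral.continuous_parametric_intervalIntegral_of_continuous'
    (continuous_inv_sqrt_angularSpeedSq hp lam) 0 (2 * Real.pi)

theorem nlsPeriod_pos {p : ℝ} (hp : 2 < p) (lam A : ℝ) : 0 < nlsPeriod p lam A :=
  intervalIntegral.intervalIntegral_pos_of_pos
    (((continuous_inv_sqrt_angularSpeedSq hp lam).comp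
      (Continuous.prodMk_right A)).intervalIntegrable _ _)
    (fun _ => inv_pos.2 (Real.sqrt_pos.2 (angularSpeedSq_pos _))) Real.two_pi_pos

theorem nlsPeriod_le {p lam A : ℝ} (hp : 2 < p) (hA : 0 ≤ A) (h : 0 < 2 * A / p - lam) :
    nlsPeriod p lam A ≤ (√(2 * A / p - lam))⁻¹ * (2 * Real.pi) := by
  have hmono := intervalIntegral.integral_mono_on (μ := MeasureTheory.volume)
    (f := fun t => (√(angularSpeedSq p lam A t))⁻¹) (g := fun _ => (√(2 * A / p - lam))⁻¹)
    Real.two_pi_pos.le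
    (((continuous_inv_sqrt_angularSpeedSq hp lam).comp
      (Continuous.prodMk_right A)).intervalIntegrable _ _)
    (continuous_const.intervalIntegrable _ _)
    fun t _ => inv_anti₀ (Real.sqrt_pos.2 h) (Real.sqrt_le_sqrt (le_angularSpeedSq hp hA t))
  rw [intervalIntegral.integral_const, smul_eq_mul, sub_zero, mul_comm (2 * Real.pi)] at hmono
  exact hmono

/-- Some integer fraction of any given length is the period of a solution. -/
theorem exists_natCast_mul_nlsPeriod_eq {L p : ℝ} (lam : ℝ) (hL : 0 < L) (hp : 2 < p) :
    ∃ (A : ℝ) (n : ℕ), 0 < A ∧ 1 ≤ 2 * A / p - lam ∧ n * nlsPeriod p lam A = L := by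
  have hp0 : 0 < p := by linarith
  set A₀ := p / 2 * (|lam| + 1) with hA₀
  have hA₀pos : 0 < A₀ := by positivity
  have hbound : ∀ A, A₀ ≤ A → 1 ≤ 2 * A / p - lam := fun A hA => by
    have h1 : |lam| + 1 ≤ 2 * A / p := by
      rw [le_div_iff₀ hp0]
      linarith
    linarith [le_abs_self lam]
  obtain ⟨n, hn⟩ := exists_nat_gt (L / nlsPeriod p lam A₀)
  have hn0 : (0 : ℝ) < n := lt_trans (div_pos hL (nlsPeriod_pos hp lam A₀)) hn
  have hle : L / n ≤ nlsPeriod p lam A₀ := by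
    rw [div_lt_iff₀ (nlsPeriod_pos hp lam A₀)] at hn
    rw [div_le_iff₀ hn0]
    linarith
  have hlim : Filter.Tendsto (fun A => (√(2 * A / p - lam))⁻¹ * (2 * Real.pi)) Filter.atTop
      (nhds 0) := by
    have h1 : Filter.Tendsto (fun A => 2 * A / p - lam) Filter.atTop Filter.atTop :=
      Filter.tendsto_atTop_add_const_right _ _
        ((Filter.tendsto_id.const_mul_atTop two_pos).atTop_div_const hp0)
    simpa using ((Real.tendsto_sqrt_atTop.comp h1).inv_tendsto_atTop).mul_const (2 * Real.pi)
  obtain ⟨A₁, hA₁, hA₁le⟩ := ((hlim.eventually_lt_const (div_pos hL hn0)).and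
    (Filter.eventually_ge_atTop A₀)).exists
  have hge : nlsPeriod p lam A₁ ≤ L / n :=
    (nlsPeriod_le hp (hA₀pos.le.trans hA₁le)
      (zero_lt_one.trans_le (hbound A₁ hA₁le))).trans hA₁.le
  obtain ⟨A, hA, hAeq⟩ := intermediate_value_Icc' hA₁le
    (continuous_nlsPeriod hp lam).continuousOn ⟨hge, hle⟩
  exact ⟨A, n, hA₀pos.trans_le hA.1, hbound A hA.1, by rw [hAeq]; field_simp⟩

theorem sq_rpow_half_sub_one (p s : ℝ) : (s ^ 2) ^ (p / 2 - 1) = |s| ^ (p - 2) := by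
  rw [← sq_abs, ← Real.rpow_natCast, ← Real.rpow_mul (abs_nonneg s)]
  congr 1
  push_cast
  ring

/-- If `θ' = √(angularSpeedSq θ)`, then `v = (sin θ)'` solves the rescaled equation
`v' = lam * sin θ - A * |sin θ| ^ (p - 2) * sin θ`. -/
theorem hasDerivAt_cos_mul_sqrt_angularSpeedSq {p lam A : ℝ} (hp : 2 < p) (hA : 0 ≤ A)
    (hbound : 1 ≤ 2 * A / p - lam) {θ : ℝ → ℝ} (hinj : Function.Injective θ)
    (hθ : ∀ x, HasDerivAt θ (√(angularSpeedSq p lam A (θ x))) x) (x : ℝ) :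
    HasDerivAt (fun x => Real.cos (θ x) * √(angularSpeedSq p lam A (θ x)))
      (lam * Real.sin (θ x) - A * |Real.sin (θ x)| ^ (p - 2) * Real.sin (θ x)) x := by
  have hp0 : 0 < p := by linarith
  have hq : 1 ≤ p / 2 := by linarith
  have hθc : Continuous θ := continuous_iff_continuousAt.2 fun y => (hθ y).continuousAt
  have hcount : {y | Real.cos (θ y) = 0}.Countable := by
    have h : {t : ℝ | Real.cos t = 0}.Countable := by
      refine (Set.countable_range fun k : ℤ => (2 * k + 1) * Real.pi / 2).mono fun t ht => ?_
      obtain ⟨k, hk⟩ := Real.cos_eq_zero_iff.1 ht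
      exact ⟨k, hk.symm⟩
    exact h.preimage_of_injOn hinj.injOn
  refine hasDerivAt_of_hasDerivAt_off_countable hcount
    (f := fun x => Real.cos (θ x) * √(angularSpeedSq p lam A (θ x)))
    (g := fun x => lam * Real.sin (θ x) - A * |Real.sin (θ x)| ^ (p - 2) * Real.sin (θ x))
    ?_ ?_ (fun y hy => ?_) x
  · have h : Continuous fun x => angularSpeedSq p lam A (θ x) :=
      (continuous_angularSpeedSq hp lam).comp (continuous_const.prodMk hθc)
    fun_prop
  · have hp2 : 0 ≤ p - 2 := by linarith
    fun_prop (disch := assumption)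
  have hcos : Real.cos (θ y) ≠ 0 := hy
  set v : ℝ → ℝ := fun x => Real.cos (θ x) * √(angularSpeedSq p lam A (θ x)) with hv
  have hvne : v y ≠ 0 := mul_ne_zero hcos (Real.sqrt_pos.2 (angularSpeedSq_pos _)).ne'
  have hsin : HasDerivAt (fun x => Real.sin (θ x)) (v y) y := (hθ y).sin
  have hsq1 : Real.sin (θ y) ^ 2 ≠ 1 := fun h => hcos (by
    have := Real.sin_sq_add_cos_sq (θ y)
    exact pow_eq_zero_iff two_ne_zero |>.1 (by linarith))
  have hdiff : DifferentiableAt ℝ v y := by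
    have h1 : DifferentiableAt ℝ (fun x => angularSpeedSq p lam A (θ x)) y := by
      simp only [angularSpeedSq_eq hp hA hbound]
      have h2 : DifferentiableAt ℝ (fun x => powSlope (p / 2) (Real.sin (θ x) ^ 2)) y :=
        (differentiableAt_powSlope hq hsq1).comp (f := fun x => Real.sin (θ x) ^ 2) y
          (hsin.differentiableAt.pow 2)
      exact ((h2.const_mul _).const_mul _).sub_const _
    exact (hθ y).differentiableAt.cos.mul (h1.sqrt (angularSpeedSq_pos _).ne')
  have henergy : ∀ x, v x ^ 2 = A * (2 / p) * (1 - (Real.sin (θ x) ^ 2) ^ (p / 2))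
      - lam * (1 - Real.sin (θ x) ^ 2) := fun x => by
    rw [hv]
    simp only
    rw [mul_pow, Real.sq_sqrt (angularSpeedSq_pos _).le, angularSpeedSq_eq hp hA hbound,
      ← one_sub_mul_powSlope, Real.cos_sq']
    ring
  have h1 := hdiff.hasDerivAt.pow 2
  have h2 := (((((hsin.pow 2).rpow_const (p := p / 2) (Or.inr hq)).const_sub 1).const_mul
    (A * (2 / p))).sub (((hsin.pow 2).const_sub 1).const_mul lam))
  have h3 := h1.unique (h2.congr_of_eventuallyEq (Filter.Eventually.of_forall henergy))
  have h4 : deriv v y =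
      lam * Real.sin (θ y) - A * |Real.sin (θ y)| ^ (p - 2) * Real.sin (θ y) := by
    simp only [Pi.pow_apply, sq_rpow_half_sub_one] at h3
    push_cast at h3
    field_simp at h3
    rw [h3]
    ring
  rw [← h4]
  exact hdiff.hasDerivAt

/-- **Existence of odd periodic solutions of the stationary NLS equation (Lemma 4.1).**
For every `L > 0`, `p > 2` and `λ ∈ ℝ` there is an odd, `L`-periodic, `C²`, not identically
zero function `φ : ℝ → ℝ` solving `φ'' + |φ|^{p-2} φ = λ φ` on all of `ℝ`. -/
theorem exists_odd_periodic_solution (L p lam : ℝ) (hL : 0 < L) (hp : 2 < p) :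
    ∃ φ : ℝ → ℝ,
      (∀ x : ℝ, φ (-x) = -φ x) ∧
      (∀ x : ℝ, φ (x + L) = φ x) ∧
      ContDiff ℝ 2 φ ∧
      φ ≠ 0 ∧
      ∀ x : ℝ, deriv (deriv φ) x + |φ x| ^ (p - 2) * φ x = lam * φ x := by
  obtain ⟨A, n, hA, hbound, hAL⟩ := exists_natCast_mul_nlsPeriod_eq lam hL hp
  obtain ⟨θ, hbij, hθ, hodd, hper⟩ := exists_odd_bijective_solution_of_periodic
    (W := fun t => √(angularSpeedSq p lam A t)) (T := 2 * Real.pi)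
    ((continuous_angularSpeedSq hp lam).comp (Continuous.prodMk_right A)).sqrt
    (fun t => Real.sqrt_pos.2 (angularSpeedSq_pos t))
    (fun t => by simp [angularSpeedSq]) Real.two_pi_pos
    (fun t => by simp [angularSpeedSq])
  set a := A ^ (p - 2)⁻¹ with ha
  have hapos : 0 < a := Real.rpow_pos_of_pos hA _
  have haA : a ^ (p - 2) = A := Real.rpow_inv_rpow hA.le (by linarith)
  set v : ℝ → ℝ := fun x => Real.cos (θ x) * √(angularSpeedSq p lam A (θ x)) with hv
  have hφ : ∀ x, HasDerivAt (fun x => a * Real.sin (θ x)) (a * v x) x :=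
    fun x => (hθ x).sin.const_mul a
  have hφ' : ∀ x, HasDerivAt (fun x => a * v x) _ x := fun x =>
    (hasDerivAt_cos_mul_sqrt_angularSpeedSq hp hA.le hbound hbij.injective hθ x).const_mul a
  have hd1 : deriv (fun x => a * Real.sin (θ x)) = fun x => a * v x := funext fun x => (hφ x).deriv
  have hd2 := funext fun x => (hφ' x).deriv
  have hθc : Continuous θ := continuous_iff_continuousAt.2 fun y => (hθ y).continuousAt
  refine ⟨fun x => a * Real.sin (θ x), fun x => by simp [hodd], ?_, ?_, ?_, fun x => ?_⟩
  · have h : Function.Periodic (fun x => a * Real.sin (θ x)) (nlsPeriod p lam A) := fun x => by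
      simp only [nlsPeriod, hper, Real.sin_add_two_pi]
    rw [← hAL]
    exact h.nat_mul n
  · rw [show (2 : WithTop ℕ∞) = 1 + 1 from rfl, contDiff_succ_iff_deriv]
    refine ⟨fun x => (hφ x).differentiableAt, by simp, ?_⟩
    rw [hd1, contDiff_one_iff_deriv]
    refine ⟨fun x => (hφ' x).differentiableAt, ?_⟩
    rw [hd2]
    have hp2 : 0 ≤ p - 2 := by linarith
    fun_prop (disch := assumption)
  · obtain ⟨x, hx⟩ := hbij.surjective (Real.pi / 2)
    intro h
    have := congrFun h x
    simp [hx, hapos.ne'] at this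
  · rw [hd1, (hφ' x).deriv, abs_mul, abs_of_pos hapos,
      Real.mul_rpow hapos.le (abs_nonneg _), haA]
    ring
end

section
/- For every p > 2 and every λ ∈ ℝ, there exist x̄ > 0 and a function u : ℝ → ℝ that is odd, of class C², not identically zero on [−x̄, x̄], and satisfies u''(x) + |u(x)|^{p−2}·u(x) = λ·u(x) for every x ∈ [−x̄, x̄], together with u(0) = 0 and u'(−x̄) = u'(x̄) = 0. -/
open Set

theorem mul_sub_le_sub_of_le_hasDerivAt {f f' : ℝ → ℝ} {a b c : ℝ} (hab : a ≤ b)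
    (hf : ∀ t ∈ Icc a b, HasDerivAt f (f' t) t) (hc : ∀ t ∈ Icc a b, c ≤ f' t) :
    c * (b - a) ≤ f b - f a := by
  refine Convex.mul_sub_le_image_sub_of_le_deriv (convex_Icc a b)
    (fun t ht => (hf t ht).continuousAt.continuousWithinAt)
    (fun t ht => (hf t (interior_subset ht)).differentiableAt.differentiableWithinAt)
    (fun t ht => ?_) a (left_mem_Icc.2 hab) b (right_mem_Icc.2 hab) hab
  rw [(hf t (interior_subset ht)).deriv]
  exact hc t (interior_subset ht)

theorem sub_le_mul_sub_of_hasDerivAt_le {f f' : ℝ → ℝ} {a b c : ℝ} (hab : a ≤ b)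
    (hf : ∀ t ∈ Icc a b, HasDerivAt f (f' t) t) (hc : ∀ t ∈ Icc a b, f' t ≤ c) :
    f b - f a ≤ c * (b - a) := by
  have := mul_sub_le_sub_of_le_hasDerivAt (f := -f) (f' := -f') (c := -c) hab
    (fun t ht => (hf t ht).neg) (fun t ht => neg_le_neg (hc t ht))
  simp only [Pi.neg_apply] at this
  linarith

theorem eqOn_Icc_of_hasDerivWithinAt_eq {E : Type*} [NormedAddCommGroup E] [NormedSpace ℝ E]
    {f g f' : ℝ → E} {a b : ℝ} (hf : ∀ t ∈ Icc a b, HasDerivWithinAt f (f' t) (Icc a b) t)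
    (hg : ∀ t ∈ Icc a b, HasDerivWithinAt g (f' t) (Icc a b) t) (h : f a = g a) :
    EqOn f g (Icc a b) := by
  refine eq_of_has_deriv_right_eq (f' := f') (fun t ht => ?_) (fun t ht => ?_)
    (fun t ht => (hf t ht).continuousWithinAt) (fun t ht => (hg t ht).continuousWithinAt) h
  · exact (hf t (mem_Icc_of_Ico ht)).mono_of_mem_nhdsWithin (Icc_mem_nhdsGE_of_mem ht)
  · exact (hg t (mem_Icc_of_Ico ht)).mono_of_mem_nhdsWithin (Icc_mem_nhdsGE_of_mem ht)

/-- A bounded Lipschitz vector field has integral curves on arbitrarily long time intervals. -/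
theorem exists_hasDerivAt_Icc_of_bounded_lipschitz {E : Type*} [NormedAddCommGroup E]
    [NormedSpace ℝ E] [CompleteSpace E] {F : E → E} {K C : NNReal} (hF : LipschitzWith K F)
    (hC : ∀ x, ‖F x‖ ≤ C) (x₀ : E) {T : ℝ} (hT : 0 ≤ T) :
    ∃ γ : ℝ → E, γ 0 = x₀ ∧ ∀ t ∈ Icc 0 T, HasDerivAt γ (F (γ t)) t := by
  have hPL : IsPicardLindelof (fun _ => F) (⟨0, left_mem_Icc.2 hT⟩ : Icc 0 T) x₀
      (C * T.toNNReal) 0 C K :=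
    { lipschitzOnWith := fun _ _ => hF.lipschitzOnWith
      continuousOn := fun _ _ => continuousOn_const
      norm_le := fun _ _ x _ => hC x
      mul_max_le := by simp [hT] }
  obtain ⟨α, hα0, hα⟩ := hPL.exists_eq_forall_mem_Icc_hasDerivWithinAt₀
  have hαc : ContinuousOn α (Icc 0 T) := fun t ht => (hα t ht).continuousWithinAt
  set w : ℝ → E := IccExtend hT (fun t : Icc 0 T => F (α t))
  have hwc : Continuous w := (hF.continuous.comp hαc.domRestrict).Icc_extend'
  have hwα : ∀ t ∈ Icc 0 T, w t = F (α t) := fun t ht => IccExtend_of_mem hT _ ht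
  set γ : ℝ → E := fun t => x₀ + ∫ s in (0 : ℝ)..t, w s with hγdef
  have hγ : ∀ t, HasDerivAt γ (w t) t := fun t =>
    (hwc.integral_hasStrictDerivAt 0 t).hasDerivAt.const_add x₀
  have heq : EqOn γ α (Icc 0 T) := eqOn_Icc_of_hasDerivWithinAt_eq
    (fun t _ => (hγ t).hasDerivWithinAt)
    (fun t ht => by rw [hwα t ht]; exact hα t ht) (by simpa [hγdef] using hα0.symm)
  refine ⟨γ, by simp [hγdef], fun t ht => (hγ t).congr_deriv ?_⟩
  rw [hwα t ht, heq ht]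

/-- Solution of the first-order system of `u'' = g u`, with both components clamped. -/
theorem exists_clamped_solution {g : ℝ → ℝ} {R B T : ℝ} (hR : 0 ≤ R) (hB : 0 ≤ B) (hT : 0 ≤ T)
    {K : NNReal} (hg : LipschitzOnWith K g (Icc 0 R)) (v₀ : ℝ) :
    ∃ u v : ℝ → ℝ, u 0 = 0 ∧ v 0 = v₀ ∧ ∀ t ∈ Icc 0 T,
      HasDerivAt u (projIcc 0 B hB (v t)) t ∧ HasDerivAt v (g (projIcc 0 R hR (u t))) t := by
  have h1 : LipschitzWith 1 (fun x : ℝ × ℝ => (projIcc 0 B hB x.2 : ℝ)) := by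
    simpa using! (LipschitzWith.subtype_val _).comp
      ((LipschitzWith.projIcc hB).comp LipschitzWith.prod_snd)
  have h2 : LipschitzWith K (fun x : ℝ × ℝ => g (projIcc 0 R hR x.1)) := by
    simpa using! hg.to_restrict.comp ((LipschitzWith.projIcc hR).comp LipschitzWith.prod_fst)
  obtain ⟨M, hM⟩ := isCompact_Icc.exists_bound_of_continuousOn hg.continuousOn
  have hC : ∀ x : ℝ × ℝ, ‖((projIcc 0 B hB x.2 : ℝ), g (projIcc 0 R hR x.1))‖
      ≤ (max B M).toNNReal := by
    intro x
    have h3 := (projIcc 0 B hB x.2).2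
    refine le_trans ?_ (Real.le_coe_toNNReal _)
    refine max_le ?_ ((hM _ (projIcc 0 R hR x.1).2).trans (le_max_right _ _))
    rw [Real.norm_of_nonneg h3.1]
    exact h3.2.trans (le_max_left _ _)
  obtain ⟨γ, h0, hγ⟩ := exists_hasDerivAt_Icc_of_bounded_lipschitz (h1.prodMk h2) hC (0, v₀) hT
  exact ⟨fun t => (γ t).1, fun t => (γ t).2, by simp [h0], by simp [h0], fun t ht =>
    ⟨(hγ t ht).fst, (hγ t ht).snd⟩⟩

/-- If `g` eventually pulls back, the solution of `u'' = g u` launched from `0` with a suitable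
positive speed stays nonnegative and increases until its speed vanishes. -/
theorem exists_solution_until_turning_point {g : ℝ → ℝ}
    (hg : ∀ R, ∃ L, LipschitzOnWith L g (Icc 0 R)) {K : ℝ} (hK : 0 < K)
    (hgK : ∀ w, K ≤ w → g w ≤ -1) :
    ∃ b > 0, ∃ u v : ℝ → ℝ, u 0 = 0 ∧ 0 < v 0 ∧ v b = 0 ∧
      ∀ t ∈ Icc 0 b, HasDerivAt u (v t) t ∧ HasDerivAt v (g (u t)) t := by
  obtain ⟨L, hL⟩ := hg K
  obtain ⟨D, hD⟩ := isCompact_Icc.exists_bound_of_continuousOn hL.continuousOn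
  have hD0 : 0 ≤ D := (norm_nonneg _).trans (hD 0 (left_mem_Icc.2 hK.le))
  have hgD : ∀ w, 0 ≤ w → g w ≤ D := fun w hw => by
    rcases le_total w K with h | h
    · exact (le_abs_self _).trans (hD w ⟨hw, h⟩)
    · linarith [hgK w h]
  set T := 1 + 2 * D + K
  have hT0 : 0 ≤ T := by positivity
  set B := D + K + D * T
  have hB0 : 0 ≤ B := by positivity
  have hR0 : 0 ≤ B * T := by positivity
  obtain ⟨L', hL'⟩ := hg (B * T)
  obtain ⟨u, v, hu0, hv0, huv⟩ := exists_clamped_solution hR0 hB0 hT0 hL' (D + K)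
  have hvB : ∀ t ∈ Icc 0 T, v t ≤ B := fun t ht => by
    have := sub_le_mul_sub_of_hasDerivAt_le ht.1
      (fun s hs => (huv s ⟨hs.1, hs.2.trans ht.2⟩).2)
      (fun s hs => hgD _ (projIcc 0 (B * T) hR0 (u s)).2.1)
    have := mul_le_mul_of_nonneg_left ht.2 hD0
    linarith
  have huR : ∀ t ∈ Icc 0 T, u t ∈ Icc 0 (B * T) := fun t ht => by
    have h1 := sub_le_mul_sub_of_hasDerivAt_le ht.1
      (fun s hs => (huv s ⟨hs.1, hs.2.trans ht.2⟩).1)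
      (fun s hs => (projIcc 0 B hB0 (v s)).2.2)
    have h2 := mul_sub_le_sub_of_le_hasDerivAt ht.1
      (fun s hs => (huv s ⟨hs.1, hs.2.trans ht.2⟩).1)
      (fun s hs => (projIcc 0 B hB0 (v s)).2.1)
    have := mul_le_mul_of_nonneg_left ht.2 hB0
    constructor <;> linarith
  have hv : ∀ t ∈ Icc 0 T, HasDerivAt v (g (u t)) t := fun t ht => by
    simpa only [projIcc_of_mem _ (huR t ht)] using (huv t ht).2
  have hu : ∀ t ∈ Icc 0 T, 0 ≤ v t → HasDerivAt u (v t) t := fun t ht h => by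
    simpa only [projIcc_of_mem hB0 ⟨h, hvB t ht⟩] using (huv t ht).1
  have hvc : ContinuousOn v (Icc 0 T) := fun t ht => (hv t ht).continuousAt.continuousWithinAt
  have hneg : ∃ t ∈ Icc 0 T, v t ≤ 0 := by
    by_contra! hpos
    have hu' : ∀ t ∈ Icc 0 T, HasDerivAt u (v t) t := fun t ht => hu t ht (hpos t ht).le
    have hmono : ∀ s ∈ Icc 0 T, ∀ t ∈ Icc 0 T, s ≤ t → u s ≤ u t := fun s hs t ht hst => by
      have := mul_sub_le_sub_of_le_hasDerivAt hst
        (fun r hr => hu' r ⟨hs.1.trans hr.1, hr.2.trans ht.2⟩)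
        (fun r hr => (hpos r ⟨hs.1.trans hr.1, hr.2.trans ht.2⟩).le)
      linarith
    have h1T : (1 : ℝ) ∈ Icc 0 T := ⟨zero_le_one, by linarith⟩
    have hsub : ∀ {t}, t ∈ Icc (0 : ℝ) 1 → t ∈ Icc 0 T := fun ht => ⟨ht.1, ht.2.trans h1T.2⟩
    have hu1 : K ≤ u 1 := by
      by_contra! hlt
      have hvK : ∀ t ∈ Icc (0 : ℝ) 1, K ≤ v t := fun t ht => by
        have := mul_sub_le_sub_of_le_hasDerivAt (c := -D) ht.1
          (fun s hs => hv s (hsub ⟨hs.1, hs.2.trans ht.2⟩))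
          (fun s hs => (abs_le.1 (hD _ ⟨(huR s (hsub ⟨hs.1, hs.2.trans ht.2⟩)).1,
            (hmono s (hsub ⟨hs.1, hs.2.trans ht.2⟩) 1 h1T (hs.2.trans ht.2)).trans hlt.le⟩)).1)
        have := mul_le_mul_of_nonneg_left ht.2 hD0
        linarith
      have := mul_sub_le_sub_of_le_hasDerivAt zero_le_one (fun s hs => hu' s (hsub hs)) hvK
      linarith
    have hv1 := sub_le_mul_sub_of_hasDerivAt_le zero_le_one (fun s hs => hv s (hsub hs))
      (fun s hs => hgD _ (huR s (hsub hs)).1)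
    have hv2 := sub_le_mul_sub_of_hasDerivAt_le h1T.2
      (fun s hs => hv s ⟨zero_le_one.trans hs.1, hs.2⟩)
      (fun s hs => hgK _ (hu1.trans (hmono 1 h1T s ⟨zero_le_one.trans hs.1, hs.2⟩ hs.1)))
    linarith [hpos T (right_mem_Icc.2 hT0)]
  have hv0pos : 0 < v 0 := by rw [hv0]; positivity
  have hIVT : ∀ t ∈ Icc 0 T, v t ≤ 0 → ∃ s ∈ Icc 0 t, v s = 0 := fun t ht h =>
    intermediate_value_Icc' ht.1 (hvc.mono (Icc_subset_Icc_right ht.2)) ⟨h, hv0pos.le⟩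
  have hcpt : IsCompact (Icc 0 T ∩ v ⁻¹' {0}) :=
    isCompact_Icc.of_isClosed_subset
      (hvc.preimage_isClosed_of_isClosed isClosed_Icc isClosed_singleton) inter_subset_left
  obtain ⟨b, ⟨hbT, hb0⟩, hbmin⟩ := hcpt.exists_isLeast (by
    obtain ⟨t, ht, h⟩ := hneg
    obtain ⟨s, hs, h⟩ := hIVT t ht h
    exact ⟨s, ⟨hs.1, hs.2.trans ht.2⟩, h⟩)
  have hb0 : v b = 0 := hb0
  refine ⟨b, hbT.1.lt_of_ne' fun h => ?_, u, v, hu0, hv0pos, hb0, fun t ht => ?_⟩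
  · exact hv0pos.ne' (h ▸ hb0)
  have htT : t ∈ Icc 0 T := ⟨ht.1, ht.2.trans hbT.2⟩
  refine ⟨hu t htT ?_, hv t htT⟩
  by_contra! h
  obtain ⟨s, hs, hs0⟩ := hIVT t htT h.le
  have hbs : b ≤ s := hbmin ⟨⟨hs.1, hs.2.trans htT.2⟩, hs0⟩
  have : s = t := le_antisymm hs.2 (ht.2.trans hbs)
  exact h.ne (this ▸ hs0)

/-- A solution of `u'' = g u` on `[0, b]` with `g` odd and `u 0 = 0` extends to an odd `C²`
function on `ℝ` which solves the equation on `[-b, b]`. -/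
theorem exists_odd_contDiff_extension {g u v : ℝ → ℝ} {b : ℝ} (hb : 0 ≤ b)
    (hg : Continuous g) (hgodd : ∀ x, g (-x) = -g x) (hu0 : u 0 = 0)
    (huv : ∀ t ∈ Icc 0 b, HasDerivAt u (v t) t ∧ HasDerivAt v (g (u t)) t) :
    ∃ U V W : ℝ → ℝ, (∀ x, U (-x) = -U x) ∧ (∀ x, V (-x) = V x) ∧ Continuous W ∧
      (∀ x, HasDerivAt U (V x) x) ∧ (∀ x, HasDerivAt V (W x) x) ∧
      EqOn V v (Icc 0 b) ∧ ∀ x ∈ Icc (-b) b, W x = g (U x) := by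
  have hg0 : g 0 = 0 := by
    have := hgodd 0
    rw [neg_zero] at this
    linarith
  have huc : ContinuousOn u (Icc 0 b) := fun t ht =>
    (huv t ht).1.continuousAt.continuousWithinAt
  set H : ℝ → ℝ := IccExtend hb (fun t : Icc 0 b => g (u t)) with hH
  have hHc : Continuous H := (hg.comp huc.domRestrict).Icc_extend'
  have hHneg : ∀ t ≤ 0, H t = 0 := fun t ht => by
    rw [hH, IccExtend_of_le_left _ _ ht]; simp [hu0, hg0]
  set W : ℝ → ℝ := fun t => H t - H (-t) with hW
  have hWc : Continuous W := by fun_prop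
  set V : ℝ → ℝ := fun t => v 0 + ∫ s in (0 : ℝ)..t, W s with hVdef
  have hV : ∀ t, HasDerivAt V (W t) t := fun t =>
    (hWc.integral_hasStrictDerivAt 0 t).hasDerivAt.const_add _
  have hVc : Continuous V := continuous_iff_continuousAt.2 fun t => (hV t).continuousAt
  set U : ℝ → ℝ := fun t => ∫ s in (0 : ℝ)..t, V s with hUdef
  have hU : ∀ t, HasDerivAt U (V t) t := fun t =>
    (hVc.integral_hasStrictDerivAt 0 t).hasDerivAt
  have hWodd : ∀ x, W (-x) = -W x := fun x => by simp [hW]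
  have hVeven : ∀ x, V (-x) = V x := fun x => by
    have := intervalIntegral.integral_comp_neg (a := 0) (b := x) W
    simp only [hWodd, intervalIntegral.integral_neg, neg_zero] at this
    rw [intervalIntegral.integral_symm 0 (-x)] at this
    simp only [hVdef]
    linarith
  have hUodd : ∀ x, U (-x) = -U x := fun x => by
    have := intervalIntegral.integral_comp_neg (a := 0) (b := x) V
    simp only [hVeven, neg_zero] at this
    rw [intervalIntegral.integral_symm 0 (-x)] at this
    simp only [hUdef]
    linarith
  have hWu : ∀ t ∈ Icc 0 b, W t = g (u t) := fun t ht => by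
    simp only [hW, hHneg (-t) (neg_nonpos.2 ht.1), sub_zero]
    rw [hH, IccExtend_of_mem _ _ ht]
  have hVv : EqOn V v (Icc 0 b) := eqOn_Icc_of_hasDerivWithinAt_eq
    (fun t _ => (hV t).hasDerivWithinAt)
    (fun t ht => by rw [hWu t ht]; exact (huv t ht).2.hasDerivWithinAt) (by simp [hVdef])
  have hUu : EqOn U u (Icc 0 b) := eqOn_Icc_of_hasDerivWithinAt_eq
    (fun t _ => (hU t).hasDerivWithinAt)
    (fun t ht => by rw [hVv ht]; exact (huv t ht).1.hasDerivWithinAt) (by simp [hUdef, hu0])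
  have hWU : ∀ t ∈ Icc 0 b, W t = g (U t) := fun t ht => by rw [hWu t ht, hUu ht]
  refine ⟨U, V, W, hUodd, hVeven, hWc, hU, hV, hVv, fun x hx => ?_⟩
  rcases le_total 0 x with h | h
  · exact hWU x ⟨h, hx.2⟩
  · have := hWU (-x) ⟨neg_nonneg.2 h, neg_le.1 hx.1⟩
    rwa [hWodd, hUodd, hgodd, neg_inj] at this

theorem exists_nls_force_le_neg_one {p : ℝ} (lam : ℝ) (hp : 2 < p) :
    ∃ K > 0, ∀ w, K ≤ w → lam * w - |w| ^ (p - 2) * w ≤ -1 := by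
  obtain ⟨K, hK⟩ := Filter.eventually_atTop.1
    ((tendsto_rpow_atTop (sub_pos.2 hp)).eventually_ge_atTop (lam + 1))
  refine ⟨max K 1, by positivity, fun w hw => ?_⟩
  have hw1 : 1 ≤ w := (le_max_right _ _).trans hw
  have := hK w ((le_max_left _ _).trans hw)
  rw [abs_of_nonneg (zero_le_one.trans hw1)]
  nlinarith

theorem exists_lipschitzOnWith_nls_force {p : ℝ} (lam : ℝ) (hp : 2 < p) (R : ℝ) :
    ∃ L, LipschitzOnWith L (fun w : ℝ => lam * w - |w| ^ (p - 2) * w) (Icc 0 R) := by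
  have h : ContDiff ℝ 1 (fun w : ℝ => lam * w - w ^ (p - 1)) :=
    (contDiff_const.mul contDiff_id).sub
      (Real.contDiff_rpow_const_of_le (n := 1) (by norm_num; linarith))
  obtain ⟨L, hL⟩ := h.contDiffOn.exists_lipschitzOnWith one_ne_zero (convex_Icc 0 R) isCompact_Icc
  have heq : EqOn (fun w : ℝ => lam * w - |w| ^ (p - 2) * w) (fun w => lam * w - w ^ (p - 1))
      (Icc 0 R) := fun w hw => by
    simp only [abs_of_nonneg hw.1]
    rw [← Real.rpow_add_one' hw.1 (by linarith)]
    ring_nf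
  refine ⟨L, fun x hx y hy => ?_⟩
  rw [heq hx, heq hy]
  exact hL hx hy

/-- **Building block for bound states on a tree with two pendants.** For every `p > 2` and
`λ ∈ ℝ` there exist `x̄ > 0` and an odd `C²` function `u : ℝ → ℝ`, not identically zero on
`[-x̄, x̄]`, solving `u'' + |u|^{p-2} u = λ u` on `[-x̄, x̄]` with `u(0) = 0` and Neumann
(Kirchhoff) conditions `u'(-x̄) = u'(x̄) = 0` at the pendant tips. -/
theorem exists_two_pendant_profile (p lam : ℝ) (hp : 2 < p) :
    ∃ xbar : ℝ, 0 < xbar ∧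
      ∃ u : ℝ → ℝ,
        (∀ x : ℝ, u (-x) = -u x) ∧
        ContDiff ℝ 2 u ∧
        (∃ x ∈ Icc (-xbar) xbar, u x ≠ 0) ∧
        (∀ x ∈ Icc (-xbar) xbar,
          deriv (deriv u) x + |u x| ^ (p - 2) * u x = lam * u x) ∧
        u 0 = 0 ∧ deriv u (-xbar) = 0 ∧ deriv u xbar = 0 := by
  set g : ℝ → ℝ := fun w => lam * w - |w| ^ (p - 2) * w with hg
  have hgc : Continuous g := by
    have : Continuous fun w : ℝ => |w| ^ (p - 2) :=
      continuous_abs.rpow_const fun _ => Or.inr (by linarith)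
    fun_prop
  obtain ⟨K, hK, hgK⟩ := exists_nls_force_le_neg_one lam hp
  obtain ⟨b, hb, u, v, hu0, hv0, hvb, huv⟩ :=
    exists_solution_until_turning_point (exists_lipschitzOnWith_nls_force lam hp) hK hgK
  obtain ⟨U, V, W, hUodd, hVeven, hWc, hU, hV, hVv, hWU⟩ :=
    exists_odd_contDiff_extension hb.le hgc (fun x => by simp only [hg, abs_neg]; ring) hu0 huv
  have hdU : deriv U = V := funext fun x => (hU x).deriv
  have hdV : deriv V = W := funext fun x => (hV x).deriv
  have hVb : V b = 0 := (hVv (right_mem_Icc.2 hb.le)).trans hvb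
  refine ⟨b, hb, U, hUodd, ?_, ?_, fun x hx => ?_, ?_, ?_, ?_⟩
  · refine contDiff_succ_iff_deriv (n := 1) |>.2
      ⟨fun x => (hU x).differentiableAt, by simp, ?_⟩
    rw [hdU, contDiff_one_iff_deriv, hdV]
    exact ⟨fun x => (hV x).differentiableAt, hWc⟩
  · by_contra! hzero
    have hU0 : HasDerivAt U 0 0 := (hasDerivAt_const 0 (0 : ℝ)).congr_of_eventuallyEq
      (Filter.eventually_of_mem (Icc_mem_nhds (neg_lt_zero.2 hb) hb) hzero)
    have := (hU 0).unique hU0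
    rw [hVv (left_mem_Icc.2 hb.le)] at this
    exact hv0.ne' this
  · rw [hdU, hdV, hWU x hx]
    simp [hg]
  · have := hUodd 0
    rw [neg_zero] at this
    linarith
  · rw [hdU, hVeven, hVb]
  · rw [hdU, hVb]
end
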